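/- Let y₁, …, y_N ∈ ℂ^m, let D₁, …, D_k be pairwise disjoint subsets of {1, …, N} whose union is {1, …, N}, and let G = ∑_{i=1}^{N} y_i y_iᴴ with eigenvalues λ₁(G) ≥ … ≥ λ_m(G) (assume k ≤ m). Then ∑_{j=1}^{k} λ_max(∑_{i∈D_j} y_i y_iᴴ) ≤ ∑_{p=1}^{k} λ_p(G). Equivalently, the performance gap Δ = f*_p − f*_f = ∑_{p=1}^{k} λ_p(G) − ∑_{j=1}^{k} λ_max(∑_{i∈D_j} y_i y_iᴴ) between the optimal objective values of the partially-connected and fully-connected DPS hybrid precoder design problems is nonnegative for every mapping {D_j} from RF chains to antennas. -/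

import Mathlib

open Matrix BigOperators

/-- The rank-one matrix `y yᴴ` with `(j,k)` entry `y_j · conj(y_k)`. -/
def outerSelf {m : ℕ} (y : Fin m → ℂ) : Matrix (Fin m) (Fin m) ℂ :=
  Matrix.of fun j k => y j * (starRingEnd ℂ) (y k)

/-- The largest eigenvalue of a Hermitian matrix. -/
noncomputable def lamMax {m : ℕ} {G : Matrix (Fin m) (Fin m) ℂ}
    (hG : G.IsHermitian) : ℝ :=
  ⨆ t, hG.eigenvalues t

/-- The Bessel inequality for an orthogonal (not necessarily normalized) family. -/
theorem sum_norm_inner_sq_div_le {F ι : Type*} [NormedAddCommGroup F] [InnerProductSpace ℂ F]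
    [Fintype ι] (z : ι → F) (hz : ∀ i j, i ≠ j → inner ℂ (z i) (z j) = 0) (v : F) :
    ∑ i, ‖inner ℂ (z i) v‖ ^ 2 / ‖z i‖ ^ 2 ≤ ‖v‖ ^ 2 := by
  classical
  have hon : Orthonormal ℂ (fun i : {i // z i ≠ 0} => ((‖z i‖⁻¹ : ℝ) : ℂ) • z i) := by
    refine ⟨fun i => ?_, fun i j hij => ?_⟩
    · have hi : ‖z i‖ ≠ 0 := norm_ne_zero_iff.2 i.2
      simp [norm_smul, hi]
    · simp [inner_smul_left, inner_smul_right, hz i j (fun h => hij (Subtype.ext h))]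
  refine le_trans (le_of_eq ?_) (hon.sum_inner_products_le v (s := Finset.univ))
  rw [← Finset.sum_subset (Finset.filter_subset (fun i => z i ≠ 0) Finset.univ) (fun i _ hi => by
    have hi : z i = 0 := by simpa using hi
    simp [hi]), Finset.sum_subtype (p := fun i => z i ≠ 0) _ (by simp)]
  refine Finset.sum_congr rfl fun i _ => ?_
  rw [inner_smul_left, norm_mul, mul_pow]
  simp
  ring

/-- A weighted sum of an antitone family with weights in `[0, 1]` of total mass at most `k` is at
most the sum of the first `k` terms. -/
theorem sum_mul_le_sum_filter_lt {m k : ℕ} (hk : 0 < k) (hkm : k ≤ m) (μ a : Fin m → ℝ)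
    (hanti : Antitone μ) (hμ : ∀ p, 0 ≤ μ p) (ha0 : ∀ p, 0 ≤ a p) (ha1 : ∀ p, a p ≤ 1)
    (hsum : ∑ p, a p ≤ k) :
    ∑ p, μ p * a p ≤ ∑ p ∈ Finset.univ.filter (fun p : Fin m => (p : ℕ) < k), μ p := by
  set q : Fin m := ⟨k - 1, by omega⟩ with hq
  have hcard : ∑ p : Fin m, (if (p : ℕ) < k then (1 : ℝ) else 0) = k := by
    rw [Finset.sum_boole, Fin.card_filter_val_lt, min_eq_right hkm]
  have hterm : ∀ p, μ p * a p ≤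
      (if (p : ℕ) < k then μ p else 0) + μ q * (a p - if (p : ℕ) < k then 1 else 0) := by
    intro p
    split_ifs with h
    · have : μ q ≤ μ p := hanti (Fin.le_def.2 (by simp only [hq]; omega))
      nlinarith [ha1 p]
    · have : μ p ≤ μ q := hanti (Fin.le_def.2 (by simp only [hq]; omega))
      nlinarith [ha0 p]
  have h := Finset.sum_le_sum fun p (_ : p ∈ Finset.univ) => hterm p
  rw [Finset.sum_add_distrib, ← Finset.mul_sum, Finset.sum_sub_distrib, hcard,
    ← Finset.sum_filter] at h
  nlinarith [hμ q]

/-- The vector of inner products of `x` with the vectors `y i`, `i ∈ S`, extended by zero. -/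
noncomputable def partialAnalysis {N m : ℕ} (y : Fin N → Fin m → ℂ) (S : Finset (Fin N))
    (x : EuclideanSpace ℂ (Fin m)) : EuclideanSpace ℂ (Fin N) :=
  WithLp.toLp 2 fun i => if i ∈ S then inner ℂ (WithLp.toLp 2 (y i)) x else 0

theorem inner_partialAnalysis {N m : ℕ} (y : Fin N → Fin m → ℂ) (S T : Finset (Fin N))
    (x x' : EuclideanSpace ℂ (Fin m)) :
    inner ℂ (partialAnalysis y S x) (partialAnalysis y T x') =
      inner ℂ x (WithLp.toLp 2 ((∑ i ∈ S ∩ T, outerSelf (y i)) *ᵥ x'.ofLp)) := by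
  have houter (i : Fin N) : outerSelf (y i) *ᵥ x'.ofLp =
      (inner ℂ (WithLp.toLp 2 (y i)) x') • y i := by
    ext j
    simp only [outerSelf, Matrix.mulVec, dotProduct, Matrix.of_apply, PiLp.inner_apply,
      RCLike.inner_apply, Pi.smul_apply, smul_eq_mul, Finset.sum_mul]
    exact Finset.sum_congr rfl fun l _ => by ring
  rw [Matrix.sum_mulVec, WithLp.toLp_sum, inner_sum]
  simp only [houter, WithLp.toLp_smul, inner_smul_right]
  rw [PiLp.inner_apply, ← Finset.sum_subset (Finset.subset_univ (S ∩ T))]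
  · refine Finset.sum_congr rfl fun i hi => ?_
    rw [Finset.mem_inter] at hi
    simp [partialAnalysis, hi.1, hi.2]
  · intro i _ hi
    rw [Finset.mem_inter, not_and_or] at hi
    rcases hi with hi | hi <;> simp [partialAnalysis, hi]

theorem inner_partialAnalysis_eigenvectorBasis {N m : ℕ} (y : Fin N → Fin m → ℂ)
    {S T U : Finset (Fin N)} (hU : S ∩ T = U) (hA : (∑ i ∈ U, outerSelf (y i)).IsHermitian)
    (x : EuclideanSpace ℂ (Fin m)) (t : Fin m) :
    inner ℂ (partialAnalysis y S x) (partialAnalysis y T (hA.eigenvectorBasis t)) =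
      (hA.eigenvalues t : ℂ) * inner ℂ x (hA.eigenvectorBasis t) := by
  subst hU
  rw [inner_partialAnalysis, hA.mulVec_eigenvectorBasis]
  simp [inner_smul_right_eq_smul]

theorem norm_sq_partialAnalysis_eigenvectorBasis {N m : ℕ} (y : Fin N → Fin m → ℂ)
    {S : Finset (Fin N)} (hA : (∑ i ∈ S, outerSelf (y i)).IsHermitian) (t : Fin m) :
    ‖partialAnalysis y S (hA.eigenvectorBasis t)‖ ^ 2 = hA.eigenvalues t := by
  have h := inner_partialAnalysis_eigenvectorBasis y (Finset.inter_self S) hA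
    (hA.eigenvectorBasis t) t
  rw [inner_self_eq_norm_sq_to_K, inner_self_eq_norm_sq_to_K,
    hA.eigenvectorBasis.orthonormal.1 t] at h
  simp only [RCLike.ofReal_one, one_pow, mul_one] at h
  rw [← Complex.ofReal_inj, Complex.ofReal_pow]
  exact h

/-- Nonnegativity of the performance gap between the partially- and
fully-connected DPS structures: for any partition `D₁,…,D_k` of `{1,…,N}`
(`k ≤ m`), with `G = ∑ᵢ yᵢ yᵢᴴ` and `μ` its eigenvalues in nonincreasing order,
`∑ⱼ λ_max(∑_{i∈Dⱼ} yᵢ yᵢᴴ) ≤ ∑_{p=1}^{k} μ_p`. -/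
theorem performance_gap_nonneg (N m k : ℕ) (hkm : k ≤ m)
    (y : Fin N → Fin m → ℂ)
    (D : Fin k → Finset (Fin N))
    (hdisj : ∀ j j', j ≠ j' → Disjoint (D j) (D j'))
    (hcover : (⋃ j, (D j : Set (Fin N))) = Set.univ)
    (hGj : ∀ j, (∑ i ∈ D j, outerSelf (y i)).IsHermitian)
    (hG : (∑ i, outerSelf (y i)).IsHermitian)
    (μ : Fin m → ℝ) (hanti : Antitone μ)
    (hperm : ∃ σ : Equiv.Perm (Fin m), μ = hG.eigenvalues ∘ σ) :
    ∑ j, lamMax (hGj j)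
      ≤ ∑ p ∈ Finset.univ.filter (fun p : Fin m => (p : ℕ) < k), μ p := by
  rcases Nat.eq_zero_or_pos k with rfl | hk
  · simp
  obtain ⟨σ, rfl⟩ := hperm
  have : Nonempty (Fin m) := ⟨⟨0, by omega⟩⟩
  choose t ht using fun j => exists_eq_ciSup_of_finite (f := (hGj j).eigenvalues)
  set x := fun j => (hGj j).eigenvectorBasis (t j) with hx
  set u := fun p => hG.eigenvectorBasis (σ p)
  set z := fun j => partialAnalysis y (D j) (x j) with hz
  set v := fun p => partialAnalysis y Finset.univ (u p) with hv
  have hzn (j) : ‖z j‖ ^ 2 = lamMax (hGj j) :=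
    (norm_sq_partialAnalysis_eigenvectorBasis y (hGj j) (t j)).trans (ht j)
  have hvn (p) : ‖v p‖ ^ 2 = (hG.eigenvalues ∘ σ) p :=
    norm_sq_partialAnalysis_eigenvectorBasis y hG (σ p)
  have hzo (i j) (hij : i ≠ j) : inner ℂ (z i) (z j) = 0 := by
    simp only [hz, inner_partialAnalysis, Finset.disjoint_iff_inter_eq_empty.1 (hdisj i j hij)]
    simp
  have hvo (p q) (hpq : p ≠ q) : inner ℂ (v p) (v q) = 0 := by
    have h := inner_partialAnalysis_eigenvectorBasis y (Finset.inter_self _) hG (u p) (σ q)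
    rwa [hG.eigenvectorBasis.orthonormal.2 (σ.injective.ne hpq), mul_zero] at h
  have hvz (p j) : ‖inner ℂ (v p) (z j)‖ ^ 2 = (‖z j‖ ^ 2) ^ 2 * ‖inner ℂ (u p) (x j)‖ ^ 2 := by
    have h := inner_partialAnalysis_eigenvectorBasis y (Finset.univ_inter (D j)) (hGj j) (u p) (t j)
    rw [← norm_sq_partialAnalysis_eigenvectorBasis] at h
    simp only [hv, hz, hx] at h ⊢
    rw [h, norm_mul, mul_pow]
    simp
  set a := fun p => ∑ j, ‖inner ℂ (v p) (z j)‖ ^ 2 / ‖v p‖ ^ 2 / ‖z j‖ ^ 2 with ha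
  have ha1 (p) : a p ≤ 1 := by
    have h := sum_norm_inner_sq_div_le z hzo (v p)
    simp only [norm_inner_symm _ (v p)] at h
    calc a p = (∑ j, ‖inner ℂ (v p) (z j)‖ ^ 2 / ‖z j‖ ^ 2) / ‖v p‖ ^ 2 := by
          rw [Finset.sum_div]
          exact Finset.sum_congr rfl fun j _ => div_right_comm _ _ _
      _ ≤ 1 := div_le_one_of_le₀ h (by positivity)
  have hasum : ∑ p, a p ≤ k := by
    rw [Finset.sum_comm]
    calc _ ≤ ∑ j : Fin k, (1 : ℝ) := Finset.sum_le_sum fun j _ => by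
          rw [← Finset.sum_div]
          exact div_le_one_of_le₀ (sum_norm_inner_sq_div_le v hvo (z j)) (by positivity)
      _ = k := by simp
  have hmul : ∑ p, (hG.eigenvalues ∘ σ) p * a p = ∑ j, lamMax (hGj j) := by
    simp only [ha, Finset.mul_sum]
    rw [Finset.sum_comm]
    refine Finset.sum_congr rfl fun j _ => ?_
    have hpar : ∑ p, ‖inner ℂ (u p) (x j)‖ ^ 2 = 1 := by
      rw [Equiv.sum_comp σ fun p => ‖inner ℂ (hG.eigenvectorBasis p) (x j)‖ ^ 2,
        hG.eigenvectorBasis.sum_sq_norm_inner_right, (hGj j).eigenvectorBasis.orthonormal.1, one_pow]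
    calc _ = ∑ p, ‖z j‖ ^ 2 * ‖inner ℂ (u p) (x j)‖ ^ 2 := Finset.sum_congr rfl fun p _ => by
          have hcancel : ‖v p‖ ^ 2 * (‖inner ℂ (v p) (z j)‖ ^ 2 / ‖v p‖ ^ 2) =
              ‖inner ℂ (v p) (z j)‖ ^ 2 := by
            rcases eq_or_ne (v p) 0 with h | h
            · simp [h]
            · exact mul_div_cancel₀ _ (pow_ne_zero 2 (norm_ne_zero_iff.2 h))
          rw [← hvn, ← mul_div_assoc, hcancel, hvz]
          rcases eq_or_ne (‖z j‖ ^ 2) 0 with h | h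
          · simp [h]
          · field_simp
      _ = lamMax (hGj j) := by rw [← Finset.mul_sum, hpar, mul_one, hzn]
  rw [← hmul]
  exact sum_mul_le_sum_filter_lt hk hkm _ a hanti (fun p => hvn p ▸ by positivity)
    (fun p => Finset.sum_nonneg fun j _ => by positivity) ha1 hasum
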